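/- arXiv:1309.3340 — 2 statements merged into one kernel-verified Lean document; each statement's English description precedes it below -/
import Mathlib

section
/- There exist finite connected simple graphs G and H such that T_G(x,y) = T_H(y,x) (the Tutte polynomial of H is obtained from that of G by exchanging the two variables) and yet the Jacobians Jac(G) and Jac(H) are not isomorphic as abelian groups. In particular, the symmetry T_G(x,y) = T_{G*}(y,x) relating the Tutte polynomials of a planar graph and its planar dual does not by itself imply that their Jacobians are isomorphic. -/
open scoped Classical

namespace BNGraph

variable {V : Type} [Fintype V]

/-- The degree of a divisor `D : V → ℤ`: the sum of its values. -/
def degSum (D : V → ℤ) : ℤ := ∑ v, D v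

/-- A divisor is effective if all its values are nonnegative. -/
def Effective (D : V → ℤ) : Prop := ∀ v, 0 ≤ D v

/-- The combinatorial Laplacian of a graph, as a homomorphism on divisors. -/
noncomputable def lap (G : SimpleGraph V) : (V → ℤ) →+ (V → ℤ) where
  toFun f := fun v => (G.degree v : ℤ) * f v - ∑ w ∈ G.neighborFinset v, f w
  map_zero' := by
    funext v; simp
  map_add' f g := by
    funext v
    simp only [Pi.add_apply, Finset.sum_add_distrib]
    ring

/-- The subgroup of principal divisors: the image of the Laplacian. -/
noncomputable def Principal (G : SimpleGraph V) : AddSubgroup (V → ℤ) := (lap G).range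

/-- Linear equivalence of divisors. -/
def LinEquiv (G : SimpleGraph V) (D D' : V → ℤ) : Prop := D - D' ∈ Principal G

/-- A divisor is winnable if it is linearly equivalent to an effective divisor. -/
def Winnable (G : SimpleGraph V) (D : V → ℤ) : Prop :=
  ∃ E : V → ℤ, Effective E ∧ LinEquiv G D E

/-- The Baker–Norine rank of a divisor: the largest `r ≥ 0` such that `D - E` is
winnable for every effective divisor `E` of degree `r`, or `-1` if there is no such `r`
(equivalently, if `D` itself is not winnable). -/
noncomputable def bnRank (G : SimpleGraph V) (D : V → ℤ) : ℤ :=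
  sSup {r : ℤ | r = -1 ∨ (0 ≤ r ∧
    ∀ E : V → ℤ, Effective E → degSum E = r → Winnable G (D - E))}

/-- The Picard group of a graph: divisors modulo principal divisors. -/
abbrev Pic (G : SimpleGraph V) : Type _ := (V → ℤ) ⧸ Principal G

/-- The number of divisor classes of degree `d` and Baker–Norine rank `r`. -/
noncomputable def numClasses (G : SimpleGraph V) (d r : ℤ) : ℕ :=
  Set.ncard {c : Pic G | ∃ D : V → ℤ,
    QuotientAddGroup.mk' (Principal G) D = c ∧ degSum D = d ∧ bnRank G D = r}

/-- Two graphs have the same two-variable zeta function iff for every degree `d` and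
rank `r` they have the same number of divisor classes of degree `d` and rank `r`. -/
def SameZeta {W : Type} [Fintype W] (G : SimpleGraph V) (G' : SimpleGraph W) : Prop :=
  ∀ d r : ℤ, numClasses G d r = numClasses G' d r

/-- Degree as a homomorphism on divisors. -/
def degHom : (V → ℤ) →+ ℤ where
  toFun := degSum
  map_zero' := by simp [degSum]
  map_add' f g := by simp [degSum, Finset.sum_add_distrib]

/-- The subgroup of divisors of degree zero. -/
def Deg0 (V : Type) [Fintype V] : AddSubgroup (V → ℤ) := (degHom (V := V)).ker

/-- The Jacobian of a graph: divisor classes of degree zero. -/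
noncomputable abbrev Jac (G : SimpleGraph V) : Type _ :=
  Deg0 V ⧸ ((Principal G).addSubgroupOf (Deg0 V))

/-- The number of connected components of the spanning subgraph with edge set `A`. -/
noncomputable def numComponents (V : Type) [Fintype V] (A : Set (Sym2 V)) : ℕ :=
  Nat.card (SimpleGraph.fromEdgeSet A).ConnectedComponent

/-- The number of edges of a graph. -/
noncomputable def edgeCount (G : SimpleGraph V) : ℕ := Nat.card G.edgeSet

open MvPolynomial in
/-- The Tutte polynomial of `G`, as a polynomial in `ℤ[x, y]` with `x = X 0`, `y = X 1`:
`T_G(x,y) = Σ_{A ⊆ E(G)} (x−1)^(c(A)−c(E(G))) (y−1)^(c(A)+|A|−|V(G)|)`. -/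
noncomputable def tutte (G : SimpleGraph V) : MvPolynomial (Fin 2) ℤ :=
  ∑ A ∈ G.edgeFinset.powerset,
    (X 0 - 1) ^ (numComponents V ↑A - numComponents V G.edgeSet) *
    (X 1 - 1) ^ (numComponents V ↑A + A.card - Fintype.card V)



/-! ### Rank of a list of edges by successive contraction -/

/-- Identify the labels `p` and `q` (the larger one survives). -/
def ren (p q x : ℕ) : ℕ := bif Nat.beq x (min p q) then max p q else x

theorem ren_eq (p q x : ℕ) : ren p q x = if x = min p q then max p q else x := by
  simp only [ren, Bool.cond_eq_ite, Nat.beq_eq]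

/-- Rank of a list of edges, relative to a labelling of the vertices. -/
def rk {V : Type} : (V → ℕ) → List (V × V) → ℕ
  | _, [] => 0
  | lab, e :: l => bif Nat.beq (lab e.1) (lab e.2) then rk lab l
      else rk (ren (lab e.1) (lab e.2) ∘ lab) l + 1

theorem rk_le {V : Type} (lab : V → ℕ) (l : List (V × V)) : rk lab l ≤ l.length := by
  induction l generalizing lab with
  | nil => simp [rk]
  | cons e l ih =>
    simp only [rk, List.length_cons]
    cases Nat.beq (lab e.1) (lab e.2)
    · simpa using ih _
    · simpa using (ih lab).trans (Nat.le_succ _)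

/-- The relation given by a list of edges. -/
def relOf {V : Type} (l : List (V × V)) (x y : V) : Prop := (x, y) ∈ l

theorem ker_ren {V : Type} (lab : V → ℕ) (a b : V) (h : lab a ≠ lab b) :
    Setoid.ker (ren (lab a) (lab b) ∘ lab) =
      Setoid.ker lab ⊔ Relation.EqvGen.setoid (fun x y => x = a ∧ y = b) := by
  apply le_antisymm
  · intro x y hxy
    set S := Setoid.ker lab ⊔ Relation.EqvGen.setoid (fun x y => x = a ∧ y = b) with hS
    have h1 : ∀ x y, lab x = lab y → S x y := fun x y hh =>
      (le_sup_left : Setoid.ker lab ≤ S) hh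
    have hab : S a b :=
      (le_sup_right : Relation.EqvGen.setoid (fun x y => x = a ∧ y = b) ≤ S)
        (Relation.EqvGen.rel _ _ ⟨rfl, rfl⟩)
    have hba : S b a := S.symm hab
    have key : ∀ x, (lab x = lab a ∨ lab x = lab b) → S x a := by
      rintro x (hx | hx)
      · exact h1 _ _ hx
      · exact S.trans (h1 _ _ hx) hba
    have hxy' : ren (lab a) (lab b) (lab x) = ren (lab a) (lab b) (lab y) := hxy
    by_cases hx : lab x = lab a ∨ lab x = lab b
    · by_cases hy : lab y = lab a ∨ lab y = lab b
      · exact S.trans (key x hx) (S.symm (key y hy))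
      · exfalso
        simp only [ren_eq] at hxy'
        split_ifs at hxy' <;> omega
    · by_cases hy : lab y = lab a ∨ lab y = lab b
      · exfalso
        simp only [ren_eq] at hxy'
        split_ifs at hxy' <;> omega
      · apply h1
        simp only [ren_eq] at hxy'
        split_ifs at hxy' <;> omega
  · apply sup_le
    · intro x y hxy
      have : lab x = lab y := hxy
      show ren _ _ (lab x) = ren _ _ (lab y)
      rw [this]
    · rw [← Setoid.eqvGen_of_setoid (Setoid.ker (ren (lab a) (lab b) ∘ lab))]
      apply Setoid.eqvGen_mono
      rintro x y ⟨rfl, rfl⟩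
      show ren _ _ (lab x) = ren _ _ (lab y)
      simp only [ren_eq]
      split_ifs <;> omega

theorem relOf_cons {V : Type} (a b : V) (l : List (V × V)) :
    Relation.EqvGen.setoid (relOf ((a, b) :: l)) =
      Relation.EqvGen.setoid (fun x y => x = a ∧ y = b) ⊔ Relation.EqvGen.setoid (relOf l) := by
  apply le_antisymm
  · apply Setoid.eqvGen_le
    intro x y h
    rcases List.mem_cons.1 (show (x, y) ∈ (a, b) :: l from h) with h | h
    · apply (le_sup_left : Relation.EqvGen.setoid (fun x y => x = a ∧ y = b) ≤ _)
      exact Relation.EqvGen.rel _ _ ⟨(Prod.ext_iff.1 h).1, (Prod.ext_iff.1 h).2⟩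
    · apply (le_sup_right : Relation.EqvGen.setoid (relOf l) ≤ _)
      exact Relation.EqvGen.rel _ _ h
  · apply sup_le
    · apply Setoid.eqvGen_mono
      rintro x y ⟨rfl, rfl⟩
      exact List.mem_cons_self
    · apply Setoid.eqvGen_mono
      intro x y h
      exact List.mem_cons_of_mem _ h

theorem range_ren {V : Type} [Finite V] (lab : V → ℕ) (a b : V) (h : lab a ≠ lab b) :
    Nat.card (Set.range (ren (lab a) (lab b) ∘ lab)) + 1 = Nat.card (Set.range lab) := by
  have hr : Set.range (ren (lab a) (lab b) ∘ lab) = Set.range lab \ {min (lab a) (lab b)} := by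
    ext x
    simp only [Set.mem_range, Function.comp, Set.mem_sdiff, Set.mem_singleton_iff]
    constructor
    · rintro ⟨y, rfl⟩
      simp only [ren_eq]
      split_ifs with hy
      · refine ⟨?_, by omega⟩
        rcases le_total (lab a) (lab b) with hh | hh
        · exact ⟨b, by omega⟩
        · exact ⟨a, by omega⟩
      · exact ⟨⟨y, rfl⟩, hy⟩
    · rintro ⟨⟨y, rfl⟩, hy⟩
      refine ⟨y, ?_⟩
      simp only [ren_eq]
      rw [if_neg hy]
  rw [hr, Nat.card_coe_set_eq, Nat.card_coe_set_eq]
  apply Set.ncard_sdiff_singleton_add_one _ (Set.toFinite _)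
  rcases le_total (lab a) (lab b) with hh | hh
  · exact ⟨a, by omega⟩
  · exact ⟨b, by omega⟩

theorem card_quot {V : Type} [Finite V] (lab : V → ℕ) (l : List (V × V)) :
    Nat.card (Quotient (Setoid.ker lab ⊔ Relation.EqvGen.setoid (relOf l))) + rk lab l =
      Nat.card (Set.range lab) := by
  induction l generalizing lab with
  | nil =>
    have : Relation.EqvGen.setoid (relOf ([] : List (V × V))) ≤ Setoid.ker lab := by
      rw [← Setoid.eqvGen_of_setoid (Setoid.ker lab)]
      apply Setoid.eqvGen_mono
      intro x y h
      simp [relOf] at h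
    rw [sup_eq_left.2 this]
    simpa [rk] using Nat.card_congr (Setoid.quotientKerEquivRange lab)
  | cons e l ih =>
    obtain ⟨a, b⟩ := e
    rw [relOf_cons, ← sup_assoc]
    by_cases h : lab a = lab b
    · have h2 : Setoid.ker lab ⊔ Relation.EqvGen.setoid (fun x y => x = a ∧ y = b)
          = Setoid.ker lab := by
        apply sup_eq_left.2
        rw [← Setoid.eqvGen_of_setoid (Setoid.ker lab)]
        apply Setoid.eqvGen_mono
        rintro x y ⟨rfl, rfl⟩
        exact h
      rw [h2, ← ih lab]
      simp [rk, Bool.cond_eq_ite, h]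
    · rw [← ker_ren lab a b h, ← range_ren lab a b h, ← ih]
      simp [rk, Bool.cond_eq_ite, h, add_assoc]

/-- The set of unordered edges of a list of pairs. -/
def eset {V : Type} (l : List (V × V)) : Set (Sym2 V) := {e | e ∈ l.map (fun p => s(p.1, p.2))}

theorem numComponents_eset {n : ℕ} (l : List (Fin n × Fin n)) :
    numComponents (Fin n) (eset l) + rk (fun v : Fin n => v.val) l = n := by
  have h := card_quot (fun v : Fin n => v.val) l
  have hr : Nat.card (Set.range (fun v : Fin n => v.val)) = n := by
    rw [Nat.card_congr (Equiv.ofInjective _ Fin.val_injective).symm]; simp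
  rw [hr] at h
  refine Eq.trans ?_ h
  congr 1
  have hs : (SimpleGraph.fromEdgeSet (eset l)).reachableSetoid =
      Setoid.ker (fun v : Fin n => v.val) ⊔ Relation.EqvGen.setoid (relOf l) := by
    apply le_antisymm
    · intro x y hxy
      obtain ⟨w⟩ : (SimpleGraph.fromEdgeSet (eset l)).Reachable x y := hxy
      induction w with
      | nil => exact Setoid.refl' _ _
      | cons hadj _ ih =>
        refine Setoid.trans' _ ?_ ih
        apply (le_sup_right : Relation.EqvGen.setoid (relOf l) ≤ _)
        simp only [SimpleGraph.fromEdgeSet_adj, eset, List.mem_map, Set.mem_ofPred_eq] at hadj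
        obtain ⟨⟨p, hp, he⟩, -⟩ := hadj
        rw [Sym2.eq_iff] at he
        rcases he with ⟨rfl, rfl⟩ | ⟨rfl, rfl⟩
        · exact Relation.EqvGen.rel _ _ hp
        · exact Relation.EqvGen.symm _ _ (Relation.EqvGen.rel _ _ hp)
    · apply sup_le
      · intro x y hxy
        have : x = y := Fin.val_injective hxy
        subst this
        exact Setoid.refl' _ _
      · rw [← Setoid.eqvGen_of_setoid (SimpleGraph.fromEdgeSet (eset l)).reachableSetoid]
        apply Setoid.eqvGen_mono
        intro x y hxy
        show (SimpleGraph.fromEdgeSet (eset l)).Reachable x y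
        by_cases hxy' : x = y
        · rw [hxy']
        · apply SimpleGraph.Adj.reachable
          rw [SimpleGraph.fromEdgeSet_adj]
          exact ⟨List.mem_map.2 ⟨_, hxy, rfl⟩, hxy'⟩
  rw [← hs]
  rfl

/-! ### Enumeration of sublists and the state-merging computation -/

/-- (number of excluded edges, rank, nullity) for all sublists. -/
def enum {V : Type} (lab : V → ℕ) (es : List (V × V)) : List (ℕ × ℕ × ℕ) :=
  es.sublists'.map (fun l => (es.length - l.length, rk lab l, l.length - rk lab l))

/-- Weighted sum over all sublists, computed by deletion and contraction. -/
def wsum {V : Type} (α β γ : ℕ) : (V → ℕ) → List (V × V) → ℕ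
  | _, [] => 1
  | lab, e :: l => bif Nat.beq (lab e.1) (lab e.2) then (α + γ) * wsum α β γ lab l
      else α * wsum α β γ lab l + β * wsum α β γ (ren (lab e.1) (lab e.2) ∘ lab) l

theorem wsum_eq {V : Type} (α β γ : ℕ) (lab : V → ℕ) (es : List (V × V)) :
    ((enum lab es).map (fun t => α ^ t.1 * β ^ t.2.1 * γ ^ t.2.2)).sum = wsum α β γ lab es := by
  induction es generalizing lab with
  | nil => simp [enum, wsum, rk]
  | cons e es ih =>
    simp only [enum, List.map_map, Function.comp_def] at ih
    simp only [enum, List.sublists'_cons, List.map_append, List.sum_append, List.map_map,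
      Function.comp_def, wsum]
    have h1 : (List.map (fun x => α ^ ((e :: es).length - x.length) * β ^ rk lab x *
        γ ^ (x.length - rk lab x)) es.sublists').sum = α * wsum α β γ lab es := by
      rw [← ih lab, ← List.sum_map_mul_left]
      congr 1
      apply List.map_congr_left
      intro l hl
      have hle : l.length ≤ es.length := (List.mem_sublists'.1 hl).length_le
      rw [List.length_cons, Nat.succ_sub hle, pow_succ]
      ring
    rw [h1]
    cases hb : Nat.beq (lab e.1) (lab e.2)
    · simp only [cond_false]
      congr 1
      rw [← ih, ← List.sum_map_mul_left]
      congr 1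
      apply List.map_congr_left
      intro l hl
      simp only [rk, hb, cond_false, List.length_cons, Nat.add_sub_add_right, Function.comp_def]
      ring
    · simp only [cond_true]
      rw [add_mul]
      congr 1
      rw [← ih, ← List.sum_map_mul_left]
      congr 1
      apply List.map_congr_left
      intro l hl
      have hle := rk_le lab l
      simp only [rk, hb, cond_true, List.length_cons, Nat.add_sub_add_right]
      rw [Nat.succ_sub hle, pow_succ]
      ring

theorem wsum_comp {V W : Type} (α β γ : ℕ) (g : W → ℕ) (f : V → W) (es : List (V × V)) :
    wsum α β γ (g ∘ f) es = wsum α β γ g (es.map (fun p => (f p.1, f p.2))) := by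
  induction es generalizing g with
  | nil => rfl
  | cons e es ih =>
    simp only [wsum, List.map_cons, Function.comp_apply, ← ih]
    rfl

/-- Equality test of edge lists. -/
def beqL : List (ℕ × ℕ) → List (ℕ × ℕ) → Bool
  | [], [] => true
  | a :: l, b :: m => Nat.beq a.1 b.1 && Nat.beq a.2 b.2 && beqL l m
  | _, _ => false

theorem beqL_eq : ∀ l m : List (ℕ × ℕ), beqL l m = true → l = m
  | [], [], _ => rfl
  | a :: l, b :: m, h => by
    simp only [beqL, Bool.and_eq_true, Nat.beq_eq] at h
    exact congrArg₂ _ (Prod.ext h.1.1 h.1.2) (beqL_eq l m h.2)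
  | [], _ :: _, h => by simp [beqL] at h
  | _ :: _, [], h => by simp [beqL] at h

/-- Add a weighted state to a table of states. -/
def ins (k : List (ℕ × ℕ)) (w : ℕ) : List (List (ℕ × ℕ) × ℕ) → List (List (ℕ × ℕ) × ℕ)
  | [] => [(k, w)]
  | s :: t => bif beqL k s.1 then (s.1, s.2 + w) :: t else s :: ins k w t

/-- Process the first edge of every state. -/
def step (α β γ : ℕ) : List (List (ℕ × ℕ) × ℕ) → List (List (ℕ × ℕ) × ℕ)
  | [] => []
  | ([], w) :: t => ins [] w (step α β γ t)
  | (e :: l, w) :: t => bif Nat.beq e.1 e.2 then ins l (w * (α + γ)) (step α β γ t)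
      else ins l (w * α)
        (ins (l.map (fun p => (ren e.1 e.2 p.1, ren e.1 e.2 p.2))) (w * β) (step α β γ t))

/-- Total value of a table of states. -/
def total (α β γ : ℕ) (T : List (List (ℕ × ℕ) × ℕ)) : ℕ :=
  (T.map (fun s => s.2 * wsum α β γ id s.1)).sum

theorem total_ins (α β γ : ℕ) (k : List (ℕ × ℕ)) (w : ℕ) (T : List (List (ℕ × ℕ) × ℕ)) :
    total α β γ (ins k w T) = w * wsum α β γ id k + total α β γ T := by
  induction T with
  | nil => simp [total, ins]
  | cons s t ih =>
    simp only [ins]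
    cases h : beqL k s.1
    · simp only [total, cond_false, List.map_cons, List.sum_cons] at ih ⊢
      rw [ih]; ring
    · rw [beqL_eq _ _ h]
      simp only [total, cond_true, List.map_cons, List.sum_cons]
      ring

theorem total_step (α β γ : ℕ) (T : List (List (ℕ × ℕ) × ℕ)) :
    total α β γ (step α β γ T) = total α β γ T := by
  induction T with
  | nil => rfl
  | cons s t ih =>
    obtain ⟨l, w⟩ := s
    have hc : total α β γ ((l, w) :: t) = w * wsum α β γ id l + total α β γ t := by
      simp [total]
    rw [hc]
    cases l with
    | nil => simp only [step, total_ins, ih]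
    | cons e l =>
      simp only [step]
      cases h : Nat.beq e.1 e.2
      · simp only [cond_false, total_ins, ih]
        have := wsum_comp α β γ id (ren e.1 e.2) l
        rw [← this]
        simp only [wsum, id, h, cond_false]
        show _ = w * (α * wsum α β γ id l + β * wsum α β γ (ren e.1 e.2 ∘ id) l) + _
        rw [Function.comp_id, Function.id_comp]
        ring
      · simp only [cond_true, total_ins, ih]
        simp only [wsum, id, h, cond_true]
        show _ = w * ((α + γ) * wsum α β γ id l) + _
        ring

/-- The final value if the table consists of one finished state. -/
def finish : List (List (ℕ × ℕ) × ℕ) → Option ℕ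
  | [([], w)] => some w
  | _ => none

/-- Repeated `step`. -/
def iter (α β γ : ℕ) : ℕ → List (List (ℕ × ℕ) × ℕ) → List (List (ℕ × ℕ) × ℕ)
  | 0, T => T
  | k + 1, T => iter α β γ k (step α β γ T)

theorem wsum_of_finish (α β γ k N : ℕ) (es : List (ℕ × ℕ))
    (h : finish (iter α β γ k [(es, 1)]) = some N) : wsum α β γ id es = N := by
  have hi : ∀ k T, total α β γ (iter α β γ k T) = total α β γ T := by
    intro k
    induction k with
    | zero => intro T; rfl
    | succ k ih => intro T; rw [iter, ih, total_step]
  have h1 := hi k [(es, 1)]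
  have h2 : total α β γ [(es, 1)] = wsum α β γ id es := by simp [total]
  rw [h2] at h1
  rw [← h1]
  generalize iter α β γ k [(es, 1)] = T at h
  unfold finish at h
  split at h
  · simp only [Option.some.injEq] at h
    subst h
    simp [total, wsum]
  · simp at h

/-! ### Multisets are determined by base-`B` sums -/

theorem multiset_eq_of_sum {B : ℕ} (hB : 1 < B) (s t : Multiset ℕ)
    (hs : s.card < B) (ht : t.card < B)
    (h : (s.map (fun x => B ^ x)).sum = (t.map (fun x => B ^ x)).sum) : s = t := by
  obtain ⟨K, hK⟩ : ∃ K, ∀ x ∈ s + t, x < K := by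
    refine ⟨(s + t).sum + 1, fun x hx => ?_⟩
    exact Nat.lt_succ_of_le (Multiset.le_sum_of_mem hx)
  have key : ∀ u : Multiset ℕ, (∀ x ∈ u, x < K) → (u.map (fun x => B ^ x)).sum =
      Nat.ofDigits B ((List.range K).map (fun i => u.count i)) := by
    intro u hu
    have h1 : ∀ K, Nat.ofDigits B ((List.range K).map (fun i => u.count i)) =
        ∑ i ∈ Finset.range K, u.count i * B ^ i := by
      intro K
      induction K with
      | zero => simp
      | succ K ih =>
        rw [List.range_succ, List.map_append, Nat.ofDigits_append, ih, Finset.sum_range_succ]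
        simp [mul_comm]
    rw [h1, Finset.sum_multiset_map_count]
    simp only [smul_eq_mul]
    apply Finset.sum_subset
    · intro x hx
      exact Finset.mem_range.2 (hu x (Multiset.mem_toFinset.1 hx))
    · intro x _ hx
      rw [Multiset.count_eq_zero_of_notMem (fun h => hx (Multiset.mem_toFinset.2 h)), zero_mul]
  rw [key s fun x hx => hK x (Multiset.mem_add.2 (Or.inl hx)),
    key t fun x hx => hK x (Multiset.mem_add.2 (Or.inr hx))] at h
  have hd : ∀ u : Multiset ℕ, u.card < B →
      ∀ d ∈ (List.range K).map (fun i => u.count i), d < B := by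
    intro u hu d hd
    obtain ⟨i, -, rfl⟩ := List.mem_map.1 hd
    exact (Multiset.count_le_card _ _).trans_lt hu
  have := Nat.ofDigits_inj_of_len_eq hB (by simp) (hd s hs) (hd t ht) h
  ext i
  by_cases hi : i < K
  · have h3 := List.map_inj_left.1 this i (List.mem_range.2 hi)
    exact h3
  · rw [Multiset.count_eq_zero_of_notMem, Multiset.count_eq_zero_of_notMem]
    · intro hx; exact hi (hK i (Multiset.mem_add.2 (Or.inr hx)))
    · intro hx; exact hi (hK i (Multiset.mem_add.2 (Or.inl hx)))

/-! ### Tutte polynomial of a graph given by an edge list -/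

/-- The simple graph with a given list of edges. -/
def gr {n : ℕ} (L : List (Fin n × Fin n)) : SimpleGraph (Fin n) :=
  SimpleGraph.fromEdgeSet (eset L)

theorem sum_powerset_list {V M : Type} [AddCommMonoid M] [DecidableEq (Sym2 V)] (L : List (V × V))
    (hL : (L.map (fun p => s(p.1, p.2))).Nodup) (g : Finset (Sym2 V) → M) :
    ∑ A ∈ (L.map (fun p => s(p.1, p.2))).toFinset.powerset, g A =
      (L.sublists'.map (fun l => g (l.map (fun p => s(p.1, p.2))).toFinset)).sum := by
  induction L generalizing g with
  | nil => simp
  | cons e L ih =>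
    rw [List.map_cons, List.nodup_cons] at hL
    rw [List.map_cons, List.toFinset_cons, Finset.sum_powerset_insert (by simpa using hL.1),
      ih hL.2, ih hL.2, List.sublists'_cons, List.map_append, List.sum_append, List.map_map]
    simp [Function.comp_def]

theorem enum_sum {V : Type} (lab : V → ℕ) (es : List (V × V)) (t : ℕ × ℕ × ℕ)
    (ht : t ∈ enum lab es) : t.1 + t.2.1 + t.2.2 = es.length := by
  obtain ⟨l, hl, rfl⟩ := List.mem_map.1 ht
  have h1 := (List.mem_sublists'.1 hl).length_le
  have h2 := rk_le lab l
  simp only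
  omega

open MvPolynomial in
theorem tutte_gr {n : ℕ} (L : List (Fin n × Fin n))
    (hL : (L.map (fun p => s(p.1, p.2))).Nodup) (hd : ∀ p ∈ L, p.1 ≠ p.2)
    (hr : rk (fun v : Fin n => v.val) L + 1 = n) :
    tutte (gr L) = ((enum (fun v : Fin n => v.val) L).map (fun t =>
      (X 0 - 1 : MvPolynomial (Fin 2) ℤ) ^ (n - 1 - t.2.1) * (X 1 - 1) ^ t.2.2)).sum := by
  have hE : (gr L).edgeSet = eset L := by
    rw [gr, SimpleGraph.edgeSet_fromEdgeSet]
    ext e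
    constructor
    · exact fun h => h.1
    · intro h
      refine ⟨h, ?_⟩
      obtain ⟨p, hp, rfl⟩ := List.mem_map.1 h
      simpa using hd p hp
  have hF : (gr L).edgeFinset = (L.map (fun p => s(p.1, p.2))).toFinset := by
    apply Finset.coe_injective
    rw [SimpleGraph.coe_edgeFinset, hE]
    ext e
    simp [eset]
  have hcE : numComponents (Fin n) (gr L).edgeSet = 1 := by
    have := numComponents_eset L
    rw [hE]; omega
  unfold tutte
  rw [hcE, hF, sum_powerset_list L hL, enum, List.map_map]
  congr 1
  apply List.map_congr_left
  intro l hl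
  have hset : ((l.map (fun p => s(p.1, p.2))).toFinset : Set (Sym2 (Fin n))) = eset l := by
    ext e
    simp [eset]
  have hc := numComponents_eset l
  have hnd : (l.map (fun p => s(p.1, p.2))).Nodup :=
    hL.sublist ((List.mem_sublists'.1 hl).map _)
  have hcard := List.toFinset_card_of_nodup hnd
  rw [List.length_map] at hcard
  have hle := rk_le (fun v : Fin n => v.val) l
  rw [hset, hcard]
  simp only [Function.comp, Fintype.card_fin]
  congr 2 <;> omega

theorem connected_gr {n : ℕ} (L : List (Fin n × Fin n))
    (hr : rk (fun v : Fin n => v.val) L + 1 = n) : (gr L).Connected := by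
  have hc : Nat.card (gr L).ConnectedComponent = 1 := by
    have := numComponents_eset L
    unfold numComponents at this
    unfold gr
    omega
  have hn : Nonempty (Fin n) := ⟨⟨0, by omega⟩⟩
  have hs := (Nat.card_eq_one_iff_unique.1 hc).1
  refine ⟨fun x y => ?_⟩
  exact SimpleGraph.ConnectedComponent.eq.1 (Subsingleton.elim _ _)

/-- Edges of the first graph (10 vertices). -/
def LG : List (Fin 10 × Fin 10) :=
  [(0, 1), (0, 2), (0, 5), (1, 3), (1, 5), (2, 4), (2, 5), (3, 4), (3, 5), (3, 7), (4, 5), (4, 7),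
   (4, 8), (5, 6), (6, 7), (6, 9), (7, 8), (7, 9), (8, 9)]

/-- Edges of the second graph (11 vertices). -/
def LH : List (Fin 11 × Fin 11) :=
  [(0, 1), (0, 5), (0, 6), (1, 2), (1, 5), (2, 3), (2, 5), (3, 6), (3, 10), (4, 6), (4, 8), (4, 10),
   (5, 7), (5, 10), (7, 9), (7, 10), (8, 9), (8, 10), (9, 10)]

/-- Comparison of the two encoded rank generating functions. -/
def compareGH (B : ℕ) : Bool :=
  match finish (iter 1 (B ^ 33) (B ^ 32) 19 [(LG.map (fun p => (p.1.val, p.2.val)), 1)]),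
    finish (iter (B ^ 33) B 1 19 [(LH.map (fun p => (p.1.val, p.2.val)), 1)]) with
  | some a, some b => Nat.beq (B ^ 10 * a) b
  | _, _ => false

theorem compareGH_true : compareGH (2 ^ 20) = true := by decide +kernel

theorem wsum_val {n : ℕ} (α β γ : ℕ) (L : List (Fin n × Fin n)) :
    wsum α β γ (fun v : Fin n => v.val) L =
      wsum α β γ id (L.map (fun p => (p.1.val, p.2.val))) :=
  wsum_comp α β γ id (fun v : Fin n => v.val) L

theorem wsum_GH : (2 ^ 20) ^ 10 * wsum 1 ((2 ^ 20) ^ 33) ((2 ^ 20) ^ 32) (fun v => v.val) LG =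
    wsum ((2 ^ 20) ^ 33) (2 ^ 20) 1 (fun v => v.val) LH := by
  have h := compareGH_true
  rw [wsum_val, wsum_val]
  generalize 2 ^ 20 = B at h ⊢
  unfold compareGH at h
  split at h
  · rename_i a b ha hb
    rw [wsum_of_finish _ _ _ _ _ _ ha, wsum_of_finish _ _ _ _ _ _ hb]
    exact Nat.eq_of_beq_eq_true h
  · simp at h

theorem wsum_codeG {V : Type} (B : ℕ) (lab : V → ℕ) (es : List (V × V)) :
    ((enum lab es).map (fun t => B ^ (10 + t.2.1 + 32 * (t.2.1 + t.2.2)))).sum =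
      B ^ 10 * wsum 1 (B ^ 33) (B ^ 32) lab es := by
  rw [← wsum_eq, ← List.sum_map_mul_left]
  refine congrArg List.sum (List.map_congr_left ?_)
  intro t _
  simp only [one_pow, one_mul, ← pow_mul, ← pow_add]
  congr 1
  ring

theorem wsum_codeH {V : Type} (B : ℕ) (lab : V → ℕ) (es : List (V × V)) :
    ((enum lab es).map (fun t => B ^ (33 * t.1 + t.2.1))).sum = wsum (B ^ 33) B 1 lab es := by
  rw [← wsum_eq]
  refine congrArg List.sum (List.map_congr_left ?_)
  intro t _
  simp only [one_pow, mul_one, ← pow_mul, ← pow_add]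

theorem codes_eq :
    (((enum (fun v => v.val) LG).map (fun t => 10 + t.2.1 + 32 * (t.2.1 + t.2.2)) : List ℕ) :
      Multiset ℕ) =
    ((enum (fun v => v.val) LH).map (fun t => 33 * t.1 + t.2.1) : List ℕ) := by
  have hcG : (enum (fun v => v.val) LG).length = 2 ^ 19 := by
    rw [enum, List.length_map, List.length_sublists']; rfl
  have hcH : (enum (fun v => v.val) LH).length = 2 ^ 19 := by
    rw [enum, List.length_map, List.length_sublists']; rfl
  apply multiset_eq_of_sum (B := 2 ^ 20) (by norm_num)
  · rw [Multiset.coe_card, List.length_map, hcG]; norm_num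
  · rw [Multiset.coe_card, List.length_map, hcH]; norm_num
  · rw [Multiset.map_coe, Multiset.map_coe, Multiset.sum_coe, Multiset.sum_coe, List.map_map,
      List.map_map]
    exact (wsum_codeG _ _ _).trans (wsum_GH.trans (wsum_codeH _ _ _).symm)

theorem rk_LG : rk (fun v : Fin 10 => v.val) LG + 1 = 10 := by decide +kernel

theorem rk_LH : rk (fun v : Fin 11 => v.val) LH + 1 = 11 := by decide +kernel

theorem nodup_LG : (LG.map (fun p => s(p.1, p.2))).Nodup := by
  refine (List.nodup_map_iff_inj_on ?_).2 ?_ <;> decide +kernel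

theorem nodup_LH : (LH.map (fun p => s(p.1, p.2))).Nodup := by
  refine (List.nodup_map_iff_inj_on ?_).2 ?_ <;> decide +kernel

theorem ne_LG : ∀ p ∈ LG, p.1 ≠ p.2 := by decide +kernel

theorem ne_LH : ∀ p ∈ LH, p.1 ≠ p.2 := by decide +kernel

open MvPolynomial in
theorem tutte_GH :
    tutte (gr LG) = MvPolynomial.rename (Equiv.swap (0 : Fin 2) 1) (tutte (gr LH)) := by
  rw [tutte_gr LG nodup_LG ne_LG rk_LG, tutte_gr LH nodup_LH ne_LH rk_LH, map_list_sum,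
    List.map_map]
  have h := congrArg (fun s : Multiset ℕ => (s.map (fun c =>
    (X 0 - 1 : MvPolynomial (Fin 2) ℤ) ^ (19 - c % 32) *
      (X 1 - 1) ^ (c / 32 + 10 - c % 32))).sum) codes_eq
  simp only [Multiset.map_coe, Multiset.sum_coe, List.map_map] at h
  refine Eq.trans ?_ (h.trans ?_)
  · refine congrArg List.sum (List.map_congr_left ?_)
    intro t ht
    have hs := enum_sum _ _ _ ht
    rw [show LG.length = 19 from rfl] at hs
    obtain ⟨u, r, l⟩ := t
    simp only at hs
    simp only [Function.comp]
    have m1 : (10 + r + 32 * (r + l)) % 32 = 10 + r := by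
      rw [Nat.add_mul_mod_self_left, Nat.mod_eq_of_lt (by omega)]
    have m2 : (10 + r + 32 * (r + l)) / 32 = r + l := by
      rw [Nat.add_mul_div_left _ _ (by norm_num), Nat.div_eq_of_lt (by omega), zero_add]
    have e1 : 19 - (10 + r + 32 * (r + l)) % 32 = 10 - 1 - r := by rw [m1]; omega
    have e2 : (10 + r + 32 * (r + l)) / 32 + 10 - (10 + r + 32 * (r + l)) % 32 = l := by
      rw [m1, m2]; omega
    rw [e1, e2]
  · refine congrArg List.sum (List.map_congr_left ?_)
    intro t ht
    have hs := enum_sum _ _ _ ht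
    rw [show LH.length = 19 from rfl] at hs
    obtain ⟨u, r, l⟩ := t
    simp only at hs
    simp only [Function.comp, map_mul, map_pow, map_sub, map_one, rename_X, Equiv.swap_apply_left,
      Equiv.swap_apply_right]
    have m0 : 33 * u + r = (u + r) + 32 * u := by ring
    have m1 : (33 * u + r) % 32 = u + r := by
      rw [m0, Nat.add_mul_mod_self_left, Nat.mod_eq_of_lt (by omega)]
    have m2 : (33 * u + r) / 32 = u := by
      rw [m0, Nat.add_mul_div_left _ _ (by norm_num), Nat.div_eq_of_lt (by omega), zero_add]
    have e1 : 19 - (33 * u + r) % 32 = l := by rw [m1]; omega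
    have e2 : (33 * u + r) / 32 + 10 - (33 * u + r) % 32 = 11 - 1 - r := by
      rw [m1, m2]; omega
    rw [e1, e2, mul_comm]

/-! ### Jacobians -/

/-- Boolean adjacency. -/
def adjB {n : ℕ} (L : List (Fin n × Fin n)) (v w : Fin n) : Bool :=
  L.any (fun p => (p.1 == v && p.2 == w) || (p.1 == w && p.2 == v))

/-- Computable Laplacian. -/
def lapB {n : ℕ} (L : List (Fin n × Fin n)) (f : Fin n → ℤ) (v : Fin n) : ℤ :=
  ∑ w, bif adjB L v w then f v - f w else 0

theorem adjB_iff {n : ℕ} (L : List (Fin n × Fin n)) (hd : ∀ p ∈ L, p.1 ≠ p.2) (v w : Fin n) :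
    (gr L).Adj v w ↔ adjB L v w = true := by
  simp only [gr, SimpleGraph.fromEdgeSet_adj, adjB, List.any_eq_true, Bool.or_eq_true,
    Bool.and_eq_true, beq_iff_eq]
  constructor
  · rintro ⟨h, -⟩
    obtain ⟨p, hp, he⟩ := List.mem_map.1 h
    exact ⟨p, hp, Sym2.eq_iff.1 he⟩
  · rintro ⟨p, hp, he⟩
    refine ⟨List.mem_map.2 ⟨p, hp, Sym2.eq_iff.2 he⟩, ?_⟩
    have := hd p hp
    rintro rfl
    rcases he with he | he <;> exact this (he.1.trans he.2.symm)

theorem lap_gr {n : ℕ} (L : List (Fin n × Fin n)) (hd : ∀ p ∈ L, p.1 ≠ p.2)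
    (f : Fin n → ℤ) : lap (gr L) f = lapB L f := by
  funext v
  show ((gr L).degree v : ℤ) * f v - ∑ w ∈ (gr L).neighborFinset v, f w = _
  have h1 : ((gr L).degree v : ℤ) * f v = ∑ w ∈ (gr L).neighborFinset v, f v := by
    rw [Finset.sum_const, SimpleGraph.card_neighborFinset_eq_degree, nsmul_eq_mul]
  rw [h1, ← Finset.sum_sub_distrib, lapB]
  have h2 : (gr L).neighborFinset v = Finset.univ.filter (fun w => adjB L v w = true) := by
    ext w
    simp [adjB_iff L hd]
  rw [h2, Finset.sum_filter]
  apply Finset.sum_congr rfl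
  intro w _
  cases adjB L v w <;> simp

theorem lapB_symm {n : ℕ} (L : List (Fin n × Fin n)) (f u : Fin n → ℤ) :
    ∑ v, u v * lapB L f v = ∑ v, f v * lapB L u v := by
  have hs : ∀ v w, adjB L v w = adjB L w v := by
    intro v w
    simp only [adjB, Bool.or_comm]
  have key : ∀ f u : Fin n → ℤ, ∑ v, u v * lapB L f v =
      ∑ v, ∑ w, (bif adjB L v w then u v * f v else 0) -
        ∑ v, ∑ w, (bif adjB L v w then u v * f w else 0) := by
    intro f u
    rw [← Finset.sum_sub_distrib]
    apply Finset.sum_congr rfl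
    intro v _
    rw [lapB, Finset.mul_sum, ← Finset.sum_sub_distrib]
    apply Finset.sum_congr rfl
    intro w _
    cases adjB L v w <;> simp [mul_sub]
  rw [key f u, key u f]
  congr 1
  · simp only [mul_comm]
  · rw [Finset.sum_comm]
    apply Finset.sum_congr rfl
    intro v _
    apply Finset.sum_congr rfl
    intro w _
    rw [hs w v, mul_comm]

/-- Preimages under the Laplacian of `2495 (e_v - e_0)`. -/
def MG : Fin 10 → Fin 10 → ℤ :=
  ![![0, 0, 0, 0, 0, 0, 0, 0, 0, 0],
    ![0, 1350, 461, 871, 699, 684, 723, 751, 728, 734],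
    ![0, 461, 1348, 697, 863, 686, 747, 778, 806, 777],
    ![0, 871, 697, 1686, 1164, 927, 1144, 1287, 1223, 1218],
    ![0, 699, 863, 1164, 1656, 933, 1216, 1368, 1457, 1347],
    ![0, 684, 686, 927, 933, 1125, 1025, 966, 961, 984],
    ![0, 723, 747, 1144, 1216, 1025, 2320, 1612, 1552, 1828],
    ![0, 751, 778, 1287, 1368, 966, 1612, 2063, 1746, 1807],
    ![0, 728, 806, 1223, 1457, 961, 1552, 1746, 2549, 1949],
    ![0, 734, 777, 1218, 1347, 984, 1828, 1807, 1949, 2693]]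

theorem MG_spec : ∀ v w : Fin 10, lapB LG (MG v) w =
    2495 * ((bif decide (w = v) then 1 else 0) - (bif decide (w = 0) then 1 else 0)) := by
  decide +kernel

/-- A vector in the kernel of the Laplacian of the second graph modulo 25. -/
def uH : Fin 11 → ℤ := ![0, 7, 2, 5, 17, 19, 24, 22, 13, 8, 14]

theorem uH_spec : ∀ v : Fin 11, lapB LH uH v % 25 = 0 := by decide +kernel

theorem lapB_sum {n : ℕ} (L : List (Fin n × Fin n)) (D : Fin n → ℤ) (M : Fin n → Fin n → ℤ)
    (w : Fin n) : lapB L (fun x => ∑ v, D v * M v x) w = ∑ v, D v * lapB L (M v) w := by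
  simp only [lapB, Finset.mul_sum]
  rw [Finset.sum_comm]
  apply Finset.sum_congr rfl
  intro x _
  cases adjB L w x
  · simp
  · simp [mul_sub, Finset.sum_sub_distrib]

theorem killG (x : Jac (gr LG)) : 2495 • x = 0 := by
  induction x using QuotientAddGroup.induction_on with
  | H D =>
    rw [← QuotientAddGroup.mk_nsmul, QuotientAddGroup.eq_zero_iff, AddSubgroup.mem_addSubgroupOf]
    refine ⟨fun x => ∑ v, D.1 v * MG v x, ?_⟩
    rw [lap_gr LG ne_LG]
    funext w
    have hD : ∑ v, D.1 v = 0 := D.2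
    rw [lapB_sum]
    simp only [MG_spec]
    have h1 : ∀ v, D.1 v * (2495 * ((bif decide (w = v) then 1 else 0) -
        (bif decide (w = 0) then 1 else 0))) = (if w = v then 2495 * D.1 v else 0) -
        D.1 v * (2495 * (bif decide (w = 0) then 1 else 0)) := by
      intro v
      by_cases h : w = v
      · simp [h]; ring
      · simp [h]
    simp only [h1, Finset.sum_sub_distrib, ← Finset.sum_mul, hD]
    simp

theorem not_killH : ¬ ∀ x : Jac (gr LH), 2495 • x = 0 := by
  intro h
  let D : Fin 11 → ℤ := ![-1, 1, 0, 0, 0, 0, 0, 0, 0, 0, 0]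
  have hD : D ∈ Deg0 (Fin 11) := by
    show ∑ v, D v = 0
    decide +kernel
  have h1 := h (QuotientAddGroup.mk (⟨D, hD⟩ : Deg0 (Fin 11)))
  rw [← QuotientAddGroup.mk_nsmul, QuotientAddGroup.eq_zero_iff,
    AddSubgroup.mem_addSubgroupOf] at h1
  obtain ⟨f, hf⟩ := h1
  rw [lap_gr LH ne_LH] at hf
  have hs := lapB_symm LH f uH
  rw [hf] at hs
  have h2 : ∑ v, uH v * (2495 • D) v = 17465 := by decide +kernel
  have h3 : (25 : ℤ) ∣ ∑ v, f v * lapB LH uH v :=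
    Finset.dvd_sum fun v _ => Dvd.dvd.mul_left (Int.dvd_of_emod_eq_zero (uH_spec v)) _
  rw [← hs] at h3
  have h4 : (25 : ℤ) ∣ 17465 := by
    rw [← h2]; exact h3
  norm_num at h4

/-- There are connected simple graphs `G` and `H` with `T_G(x,y) = T_H(y,x)` whose
Jacobians are not isomorphic as abelian groups.  (In particular, the symmetry
`T_G(x,y) = T_{G*}(y,x)` between a planar graph and its dual does not by itself
imply that their Jacobians are isomorphic.) -/
theorem exists_swappedTutte_nonIsoJac :
    ∃ (n m : ℕ) (G : SimpleGraph (Fin n)) (H : SimpleGraph (Fin m)),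
      G.Connected ∧ H.Connected ∧
      tutte G = MvPolynomial.rename (Equiv.swap (0 : Fin 2) 1) (tutte H) ∧
      ¬ Nonempty (Jac G ≃+ Jac H) := by
  refine ⟨10, 11, gr LG, gr LH, connected_gr LG rk_LG, connected_gr LH rk_LH, tutte_GH, ?_⟩
  rintro ⟨φ⟩
  apply not_killH
  intro x
  rw [← φ.apply_symm_apply x, ← map_nsmul, killG, map_zero]

end BNGraph
end

section
/- The graphs G₁ and G₂ have equal Tutte polynomials and isomorphic Jacobians, but they do not have the same two-variable zeta function: the number of divisor classes of degree 2 and Baker–Norine rank 1 on G₁ (which is 0) differs from the number on G₂ (which is 1). -/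
open scoped Classical

namespace BNGraph

variable {V : Type} [Fintype V]

/-- `G₁`: the diamond graph (`K₄` minus an edge) on vertices `0,1,2,3`
(with `u = 0`, `v = 1` of degree 3 and `x = 2`, `y = 3` of degree 2),
with a triangle `0,4,5` attached at the vertex `u = 0`. -/
def G1 : SimpleGraph (Fin 6) :=
  SimpleGraph.fromEdgeSet
    {s(0,1), s(0,2), s(0,3), s(1,2), s(1,3), s(0,4), s(0,5), s(4,5)}

/-- `G₂`: the diamond graph (`K₄` minus an edge) on vertices `0,1,2,3`
(with `u = 0`, `v = 1` of degree 3 and `x = 2`, `y = 3` of degree 2),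
with a triangle `2,4,5` attached at the vertex `x = 2`. -/
def G2 : SimpleGraph (Fin 6) :=
  SimpleGraph.fromEdgeSet
    {s(0,1), s(0,2), s(0,3), s(1,2), s(1,3), s(2,4), s(2,5), s(4,5)}

/-! ### The Laplacian and the classification of divisor classes -/

theorem lap_apply' (G : SimpleGraph V) (f : V → ℤ) (v : V) :
    lap G f v = ∑ w, if G.Adj v w then f v - f w else 0 := by
  show (G.degree v : ℤ) * f v - ∑ w ∈ G.neighborFinset v, f w = _
  rw [← Finset.sum_filter, ← SimpleGraph.neighborFinset_eq_filter, Finset.sum_sub_distrib,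
    Finset.sum_const, SimpleGraph.card_neighborFinset_eq_degree, nsmul_eq_mul]

/-- A weight functional with values in `ZMod 24`. -/
def phi (c : Fin 6 → ℤ) : (Fin 6 → ℤ) →+ ZMod 24 where
  toFun D := ((∑ v, c v * D v : ℤ) : ZMod 24)
  map_zero' := by simp
  map_add' f g := by simp [mul_add, Finset.sum_add_distrib]

theorem phi_eq_zero (c D : Fin 6 → ℤ) : phi c D = 0 ↔ (24 : ℤ) ∣ ∑ v, c v * D v := by
  show ((∑ v, c v * D v : ℤ) : ZMod 24) = 0 ↔ _
  exact ZMod.intCast_zmod_eq_zero_iff_dvd _ 24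

def c1 : Fin 6 → ℤ := ![0, 6, 3, 15, 8, 16]
def c2 : Fin 6 → ℤ := ![-3, 3, 0, 12, 8, 16]

theorem lap_G1 (f : Fin 6 → ℤ) : lap G1 f =
    ![5 * f 0 - f 1 - f 2 - f 3 - f 4 - f 5, 3 * f 1 - f 0 - f 2 - f 3, 2 * f 2 - f 0 - f 1,
      2 * f 3 - f 0 - f 1, 2 * f 4 - f 0 - f 5, 2 * f 5 - f 0 - f 4] := by
  funext v
  rw [lap_apply']
  fin_cases v <;> simp [G1, Fin.sum_univ_six] <;> ring

theorem lap_G2 (f : Fin 6 → ℤ) : lap G2 f =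
    ![3 * f 0 - f 1 - f 2 - f 3, 3 * f 1 - f 0 - f 2 - f 3, 4 * f 2 - f 0 - f 1 - f 4 - f 5,
      2 * f 3 - f 0 - f 1, 2 * f 4 - f 2 - f 5, 2 * f 5 - f 2 - f 4] := by
  funext v
  rw [lap_apply']
  fin_cases v <;> simp [G2, Fin.sum_univ_six] <;> ring

theorem principal_G1 (D : Fin 6 → ℤ) : D ∈ Principal G1 ↔ degSum D = 0 ∧ phi c1 D = 0 := by
  rw [phi_eq_zero]
  simp only [degSum, Fin.sum_univ_six, c1]
  constructor
  · rintro ⟨f, rfl⟩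
    rw [lap_G1]
    simp
    constructor
    · ring
    · omega
  · simp
    rintro h ⟨k, hk⟩
    refine ⟨![0, (2 * D 1 + D 2 + D 3) / 4, (D 2 + (2 * D 1 + D 2 + D 3) / 4) / 2,
      (D 3 + (2 * D 1 + D 2 + D 3) / 4) / 2, (2 * D 4 + D 5) / 3, (D 4 + 2 * D 5) / 3], ?_⟩
    rw [lap_G1]
    funext v
    fin_cases v <;> simp <;> omega

theorem principal_G2 (D : Fin 6 → ℤ) : D ∈ Principal G2 ↔ degSum D = 0 ∧ phi c2 D = 0 := by
  rw [phi_eq_zero]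
  simp only [degSum, Fin.sum_univ_six, c2]
  constructor
  · rintro ⟨f, rfl⟩
    rw [lap_G2]
    simp
    constructor
    · ring
    · omega
  · simp
    rintro h ⟨k, hk⟩
    refine ⟨![(D 0 + D 1 + D 3 + (D 0 - D 1) / 4) / 2,
      D 0 + D 1 + D 3 - (D 0 + D 1 + D 3 + (D 0 - D 1) / 4) / 2, 0,
      (D 0 + D 1 + D 3 + D 3) / 2, (2 * D 4 + D 5) / 3, (D 4 + 2 * D 5) / 3], ?_⟩
    rw [lap_G2]
    funext v
    fin_cases v <;> simp <;> omega

/-! ### Jacobians -/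

theorem jac_zmod (G : SimpleGraph (Fin 6)) (c d : Fin 6 → ℤ) (hd : degSum d = 0)
    (hcd : phi c d = 1)
    (h : ∀ D, D ∈ Principal G ↔ degSum D = 0 ∧ phi c D = 0) :
    Nonempty (Jac G ≃+ ZMod 24) := by
  let ψ : Deg0 (Fin 6) →+ ZMod 24 := (phi c).comp (Deg0 (Fin 6)).subtype
  have hk : (Principal G).addSubgroupOf (Deg0 (Fin 6)) = ψ.ker := by
    ext ⟨D, hD⟩
    have hD' : degSum D = 0 := hD
    rw [AddSubgroup.mem_addSubgroupOf, AddMonoidHom.mem_ker, h]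
    exact ⟨fun h => h.2, fun h => ⟨hD', h⟩⟩
  have hs : Function.Surjective ψ := by
    intro z
    refine ⟨z.val • ⟨d, hd⟩, ?_⟩
    rw [map_nsmul]
    show z.val • phi c d = z
    rw [hcd]
    simp
  exact ⟨(QuotientAddGroup.quotientAddEquivOfEq hk).trans
    (QuotientAddGroup.quotientKerEquivOfSurjective ψ hs)⟩

theorem jac_iso : Nonempty (Jac G1 ≃+ Jac G2) := by
  obtain ⟨e1⟩ := jac_zmod G1 c1 ![-2, 0, 3, 0, -1, 0] (by simp [degSum, Fin.sum_univ_six])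
    (by simp [phi, Fin.sum_univ_six, c1]; decide) principal_G1
  obtain ⟨e2⟩ := jac_zmod G2 c2 ![0, 3, -2, 0, -1, 0] (by simp [degSum, Fin.sum_univ_six])
    (by simp [phi, Fin.sum_univ_six, c2]; decide) principal_G2
  exact ⟨e1.trans e2.symm⟩

/-! ### Counting classes -/

theorem degSum_sub (D E : Fin 6 → ℤ) : degSum (D - E) = degSum D - degSum E :=
  map_sub degHom D E

theorem degSum_single (v : Fin 6) (n : ℤ) : degSum (Pi.single v n : Fin 6 → ℤ) = n := by
  simp [degSum]

theorem phi_single (c : Fin 6 → ℤ) (v : Fin 6) (n : ℤ) :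
    phi c (Pi.single v n) = ((c v * n : ℤ) : ZMod 24) := by
  simp [phi, Pi.single_apply]

theorem eff_single (v : Fin 6) (n : ℤ) (hn : 0 ≤ n) : Effective (Pi.single v n : Fin 6 → ℤ) := by
  intro w
  by_cases h : w = v
  · subst h; simpa
  · simp [h]

theorem eff_zero (E : Fin 6 → ℤ) (hE : Effective E) (h : degSum E = 0) : E = 0 := by
  have := (Finset.sum_eq_zero_iff_of_nonneg (fun i _ => hE i)).1 h
  funext i
  exact this i (Finset.mem_univ _)

theorem eff_one (E : Fin 6 → ℤ) (hE : Effective E) (h : degSum E = 1) :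
    ∃ w, E = Pi.single w 1 := by
  have : ∃ w, 1 ≤ E w := by
    by_contra hc
    push Not at hc
    have h0 : degSum E = 0 := Finset.sum_eq_zero (fun i _ => by
      have := hE i
      have := hc i
      omega)
    omega
  obtain ⟨w, hw⟩ := this
  refine ⟨w, ?_⟩
  have := eff_zero (E - Pi.single w 1) (by
    intro v
    by_cases hv : v = w
    · subst hv; simpa using hw
    · simpa [hv] using hE v) (by rw [degSum_sub, degSum_single, h]; rfl)
  exact sub_eq_zero.1 this

theorem rank_one (G : SimpleGraph (Fin 6)) (D : Fin 6 → ℤ) (h : bnRank G D = 1) :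
    ∀ E : Fin 6 → ℤ, Effective E → degSum E = 1 → Winnable G (D - E) := by
  unfold bnRank at h
  set S := {r : ℤ | r = -1 ∨ (0 ≤ r ∧
    ∀ E : Fin 6 → ℤ, Effective E → degSum E = r → Winnable G (D - E))} with hS
  have hb : BddAbove S := by
    by_contra hb
    rw [Int.csSup_of_not_bddAbove hb] at h
    omega
  have hm := Int.csSup_mem (s := S) ⟨-1, Or.inl rfl⟩ hb
  rw [h] at hm
  rcases hm with hm | hm
  · omega
  · exact hm.2

theorem rank_one_phi (G : SimpleGraph (Fin 6)) (c : Fin 6 → ℤ)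
    (hP : ∀ D, D ∈ Principal G ↔ degSum D = 0 ∧ phi c D = 0) (D : Fin 6 → ℤ)
    (hd : degSum D = 2) (h : bnRank G D = 1) (v : Fin 6) :
    ∃ w, phi c D = (c v : ZMod 24) + (c w : ZMod 24) := by
  obtain ⟨E, hE, hl⟩ := rank_one G D h (Pi.single v 1) (eff_single v 1 (by norm_num))
    (degSum_single v 1)
  obtain ⟨h1, h2⟩ := (hP _).1 hl
  rw [degSum_sub, degSum_sub, degSum_single, hd] at h1
  obtain ⟨w, rfl⟩ := eff_one E hE (by omega)
  refine ⟨w, ?_⟩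
  rw [map_sub, map_sub, phi_single, phi_single] at h2
  simp only [mul_one] at h2
  linear_combination h2

theorem num_G1 : numClasses G1 2 1 = 0 := by
  unfold numClasses
  refine (congrArg Set.ncard (Set.eq_empty_iff_forall_notMem.2 ?_)).trans (Set.ncard_empty _)
  rintro _ ⟨D, -, hd, hr⟩
  have h := rank_one_phi G1 c1 principal_G1 D hd hr
  generalize phi c1 D = t at h
  revert t
  decide

theorem winnable_G2 (v w : Fin 6) (h : ((c2 v : ℤ) : ZMod 24) + ((c2 w : ℤ) : ZMod 24) = 0) :
    Winnable G2 (Pi.single 2 2 - Pi.single v 1) := by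
  refine ⟨Pi.single w 1, eff_single w 1 (by norm_num), (principal_G2 _).2 ⟨?_, ?_⟩⟩
  · simp only [degSum_sub, degSum_single]; norm_num
  · simp only [map_sub, phi_single, mul_one]
    have : (c2 2 : ℤ) = 0 := rfl
    rw [this]
    simp only [zero_mul, Int.cast_zero]
    linear_combination -h

theorem rank_G2 (D : Fin 6 → ℤ) (hD : D = Pi.single 2 2) : bnRank G2 D = 1 := by
  apply IsGreatest.csSup_eq
  constructor
  · refine Or.inr ⟨by norm_num, fun E hE h1 => ?_⟩
    obtain ⟨v, rfl⟩ := eff_one E hE h1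
    have : ∀ v, ∃ w, ((c2 v : ℤ) : ZMod 24) + ((c2 w : ℤ) : ZMod 24) = 0 := by decide
    obtain ⟨w, hw⟩ := this v
    rw [hD]
    exact winnable_G2 v w hw
  · rintro r (rfl | ⟨h0, h⟩)
    · norm_num
    · by_contra hlt
      push Not at hlt
      obtain ⟨F, hF, hl⟩ := h (Pi.single 0 r) (eff_single 0 r h0) (degSum_single 0 r)
      obtain ⟨h1, h2⟩ := (principal_G2 _).1 hl
      rw [hD, degSum_sub, degSum_sub, degSum_single, degSum_single] at h1
      have hF0 : 0 ≤ degSum F := Finset.sum_nonneg (fun i _ => hF i)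
      have hr : r = 2 := by omega
      subst hr
      have := eff_zero F hF (by omega)
      subst this
      rw [hD, sub_zero, map_sub, phi_single, phi_single] at h2
      revert h2
      decide

theorem num_G2 : numClasses G2 2 1 = 1 := by
  unfold numClasses
  rw [Set.ncard_eq_one]
  refine ⟨QuotientAddGroup.mk' (Principal G2) (Pi.single 2 2), ?_⟩
  ext q
  simp only [Set.mem_ofPred_eq, Set.mem_singleton_iff]
  constructor
  · rintro ⟨D, rfl, hd, hr⟩
    have h := rank_one_phi G2 c2 principal_G2 D hd hr
    have ht : phi c2 D = 0 := by
      generalize phi c2 D = t at h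
      revert t
      decide
    have : Pi.single 2 2 - D ∈ Principal G2 := by
      rw [principal_G2, degSum_sub, degSum_single, hd, map_sub, ht, phi_single]
      exact ⟨by norm_num, by decide⟩
    refine (QuotientAddGroup.eq).2 ?_
    rwa [neg_add_eq_sub]
  · rintro rfl
    exact ⟨_, rfl, degSum_single 2 2, rank_G2 _ rfl⟩

/-! ### Tutte polynomials -/

/-- Merge the classes of `a` and `b` in a labelling. -/
def merge (l : Fin 6 → Fin 6) (p : Fin 6 × Fin 6) : Fin 6 → Fin 6 :=
  fun v => if l v = l p.1 then l p.2 else l v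

def labels : List (Fin 6 × Fin 6) → Fin 6 → Fin 6
  | [] => id
  | p :: L => merge (labels L) p

/-- The edge set given by a list of pairs. -/
def edgesOf (L : List (Fin 6 × Fin 6)) : Set (Sym2 (Fin 6)) := {e | ∃ p ∈ L, s(p.1, p.2) = e}

theorem labels_reach (L : List (Fin 6 × Fin 6)) :
    ∀ v, (SimpleGraph.fromEdgeSet (edgesOf L)).Reachable (labels L v) v := by
  induction L with
  | nil => intro v; exact SimpleGraph.Reachable.refl _
  | cons p L ih =>
    have hle : SimpleGraph.fromEdgeSet (edgesOf L) ≤ SimpleGraph.fromEdgeSet (edgesOf (p :: L)) :=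
      SimpleGraph.fromEdgeSet_mono (fun e ⟨q, hq, h⟩ => ⟨q, List.mem_cons_of_mem _ hq, h⟩)
    have ih' := fun v => (ih v).mono hle
    have hp : (SimpleGraph.fromEdgeSet (edgesOf (p :: L))).Reachable p.2 p.1 := by
      by_cases h : p.2 = p.1
      · rw [h]
      · apply SimpleGraph.Adj.reachable
        rw [SimpleGraph.fromEdgeSet_adj]
        exact ⟨⟨p, List.mem_cons_self, Sym2.eq_swap⟩, h⟩
    intro v
    show (SimpleGraph.fromEdgeSet (edgesOf (p :: L))).Reachable
      (if labels L v = labels L p.1 then labels L p.2 else labels L v) v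
    split_ifs with h
    · have h3 := ih' v
      rw [h] at h3
      exact (ih' p.2).trans (hp.trans ((ih' p.1).symm.trans h3))
    · exact ih' v

theorem labels_edge (L : List (Fin 6 × Fin 6)) :
    ∀ p ∈ L, labels L p.1 = labels L p.2 := by
  induction L with
  | nil => simp
  | cons q L ih =>
    intro p hp
    rcases List.mem_cons.1 hp with rfl | hp
    · simp [labels, merge]
    · simp [labels, merge, ih p hp]

theorem labels_adj (L : List (Fin 6 × Fin 6)) (v w : Fin 6)
    (h : (SimpleGraph.fromEdgeSet (edgesOf L)).Adj v w) : labels L v = labels L w := by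
  rw [SimpleGraph.fromEdgeSet_adj] at h
  obtain ⟨⟨p, hp, he⟩, -⟩ := h
  have := labels_edge L p hp
  rcases Sym2.eq_iff.1 he with ⟨rfl, rfl⟩ | ⟨rfl, rfl⟩
  · exact this
  · exact this.symm

theorem labels_of_reachable (L : List (Fin 6 × Fin 6)) (v w : Fin 6)
    (h : (SimpleGraph.fromEdgeSet (edgesOf L)).Reachable v w) : labels L v = labels L w := by
  obtain ⟨p⟩ := h
  induction p with
  | nil => rfl
  | cons h p ih => exact (labels_adj L _ _ h).trans ih

def count (L : List (Fin 6 × Fin 6)) : ℕ := (Finset.univ.image (labels L)).card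

theorem numComponents_eq (L : List (Fin 6 × Fin 6)) :
    numComponents (Fin 6) (edgesOf L) = count L := by
  unfold numComponents count
  let f : (SimpleGraph.fromEdgeSet (edgesOf L)).ConnectedComponent → Fin 6 :=
    fun C => C.lift (labels L) (fun v w p _ => labels_of_reachable L v w ⟨p⟩)
  have hf : Function.Injective f := by
    intro C C'
    refine SimpleGraph.ConnectedComponent.ind₂ (fun v w h => ?_) C C'
    have h' : labels L v = labels L w := h
    have h1 := labels_reach L v
    rw [h'] at h1
    exact SimpleGraph.ConnectedComponent.sound (h1.symm.trans (labels_reach L w))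
  rw [← Nat.card_range_of_injective hf]
  have hr : Set.range f = ↑(Finset.univ.image (labels L)) := by
    ext x
    simp only [Set.mem_range, Finset.coe_image, Finset.coe_univ, Set.image_univ]
    constructor
    · rintro ⟨C, rfl⟩
      refine SimpleGraph.ConnectedComponent.ind (fun v => ?_) C
      exact ⟨v, rfl⟩
    · rintro ⟨v, rfl⟩
      exact ⟨SimpleGraph.connectedComponentMk _ v, rfl⟩
  rw [hr, Nat.card_coe_set_eq, Set.ncard_coe_finset]

def p1 : Fin 8 → Fin 6 × Fin 6 :=
  ![(0,1), (0,2), (0,3), (1,2), (1,3), (0,4), (0,5), (4,5)]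
def p2 : Fin 8 → Fin 6 × Fin 6 :=
  ![(0,1), (0,2), (0,3), (1,2), (1,3), (2,4), (2,5), (4,5)]

def sel (p : Fin 8 → Fin 6 × Fin 6) (S : Finset (Fin 8)) : List (Fin 6 × Fin 6) :=
  ((List.finRange 8).filter (· ∈ S)).map p

def ed (p : Fin 8 → Fin 6 × Fin 6) (i : Fin 8) : Sym2 (Fin 6) := s((p i).1, (p i).2)

theorem edgesOf_sel (p : Fin 8 → Fin 6 × Fin 6) (S : Finset (Fin 8)) :
    edgesOf (sel p S) = ↑(S.image (ed p)) := by
  ext e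
  simp [edgesOf, sel, ed]

theorem count_eq : ∀ S : Finset (Fin 8), count (sel p1 S) = count (sel p2 S) := by
  decide +kernel

open MvPolynomial in
theorem tutte_form (G : SimpleGraph (Fin 6)) (p : Fin 8 → Fin 6 × Fin 6)
    (hinj : Function.Injective (ed p)) (hG : G.edgeFinset = Finset.univ.image (ed p)) :
    tutte G = ∑ S : Finset (Fin 8),
      (X 0 - 1) ^ (count (sel p S) - count (sel p Finset.univ)) *
      (X 1 - 1) ^ (count (sel p S) + S.card - Fintype.card (Fin 6)) := by
  have hE : G.edgeSet = edgesOf (sel p Finset.univ) := by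
    rw [edgesOf_sel, ← hG, SimpleGraph.coe_edgeFinset]
  unfold tutte
  rw [hG, hE, numComponents_eq]
  symm
  apply Finset.sum_bij (fun S _ => S.image (ed p))
  · intro S _
    rw [Finset.mem_powerset]
    exact Finset.image_subset_image (Finset.subset_univ S)
  · intro S _ T _ h
    exact Finset.image_injective hinj h
  · intro A hA
    rw [Finset.mem_powerset] at hA
    obtain ⟨S, -, hS⟩ := Finset.subset_image_iff.1 hA
    exact ⟨S, Finset.mem_univ _, hS⟩
  · intro S _
    rw [← edgesOf_sel, numComponents_eq, Finset.card_image_of_injective _ hinj]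

theorem edges_form (G : SimpleGraph (Fin 6)) (p : Fin 8 → Fin 6 × Fin 6)
    (hp : ∀ i, ¬ (ed p i).IsDiag) (hG : G = SimpleGraph.fromEdgeSet (Set.range (ed p))) :
    G.edgeFinset = Finset.univ.image (ed p) := by
  ext e
  rw [SimpleGraph.mem_edgeFinset, hG, SimpleGraph.edgeSet_fromEdgeSet]
  simp only [Finset.mem_image, Finset.mem_univ, true_and]
  constructor
  · rintro ⟨h, -⟩
    exact h
  · rintro ⟨i, rfl⟩
    exact ⟨⟨i, rfl⟩, hp i⟩

theorem tutte_eq : tutte G1 = tutte G2 := by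
  rw [tutte_form G1 p1 (by decide) ?_, tutte_form G2 p2 (by decide) ?_]
  · simp only [count_eq]
  · exact edges_form G2 p2 (by decide) (by
      unfold G2
      congr 1
      ext e
      simp [ed, p2, Fin.exists_fin_succ, @eq_comm _ e])
  · exact edges_form G1 p1 (by decide) (by
      unfold G1
      congr 1
      ext e
      simp [ed, p1, Fin.exists_fin_succ, @eq_comm _ e])

/-- `G₁` and `G₂` have equal Tutte polynomials and isomorphic Jacobians, but not the
same two-variable zeta function: `G₁` has no divisor class of degree 2 and
Baker–Norine rank 1, while `G₂` has exactly one such class. -/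
theorem G1_G2_sameTutte_isoJac_differentZeta :
    tutte G1 = tutte G2 ∧
    Nonempty (Jac G1 ≃+ Jac G2) ∧
    numClasses G1 2 1 = 0 ∧ numClasses G2 2 1 = 1 := by
  exact ⟨tutte_eq, jac_iso, num_G1, num_G2⟩

end BNGraph
end
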